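/- arXiv:2509.12856 — 5 statements merged into one kernel-verified Lean document; each statement's English description precedes it below -/
import Mathlib

section
/- Let G be a group and T > 0 a real number. Suppose C₊, C₋ : G → ℝ satisfy, for all g, h ∈ G: (i) C₋(g) ≤ C₊(g); (ii) C₊(1) = C₋(1) = 0; (iii) C₊(g·h) ≤ C₊(g) + ⌈C₊(h)⌉_T and C₋(g·h) ≥ C₋(g) + ⌊C₋(h)⌋_T; (iv) ⌈C₊(h·g·h⁻¹)⌉_T = ⌈C₊(g)⌉_T and ⌊C₋(h·g·h⁻¹)⌋_T = ⌊C₋(g)⌋_T; (v) ⌈C₊(g)⌉_T = −⌊C₋(g⁻¹)⌋_T. Then the function μ : G → ℝ defined by μ(g) := max{⌈C₊(g)⌉_T, −⌊C₋(g)⌋_T} is a conjugation-invariant pseudo-norm: μ(g) ≥ 0 for all g, μ(1) = 0, μ(g⁻¹) = μ(g) for all g, μ(g·h) ≤ μ(g) + μ(h) for all g, h, and μ(h·g·h⁻¹) = μ(g) for all g, h. -/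
/-- `Tceil T x = T * ⌈x / T⌉`, the smallest integer multiple of `T` that is `≥ x`. -/
noncomputable def Tceil (T x : ℝ) : ℝ := T * ⌈x / T⌉

/-- `Tfloor T x = T * ⌊x / T⌋`, the largest integer multiple of `T` that is `≤ x`. -/
noncomputable def Tfloor (T x : ℝ) : ℝ := T * ⌊x / T⌋

theorem le_Tceil {T : ℝ} (hT : 0 < T) (x : ℝ) : x ≤ Tceil T x := by
  rw [Tceil, mul_comm, ← div_le_iff₀ hT]
  exact Int.le_ceil _

theorem Tfloor_le {T : ℝ} (hT : 0 < T) (x : ℝ) : Tfloor T x ≤ x := by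
  rw [Tfloor, mul_comm, ← le_div_iff₀ hT]
  exact Int.floor_le _

theorem Tceil_le_add {T : ℝ} (hT : 0 < T) {x y z : ℝ} (h : x ≤ y + Tceil T z) :
    Tceil T x ≤ Tceil T y + Tceil T z := by
  have hy := h.trans (add_le_add_left (le_Tceil hT y) _)
  unfold Tceil at hy ⊢
  rw [← mul_add] at hy ⊢
  refine mul_le_mul_of_nonneg_left ?_ hT.le
  rw [← Int.cast_add, Int.cast_le, Int.ceil_le, div_le_iff₀ hT, mul_comm, Int.cast_add]
  exact hy

theorem add_le_Tfloor {T : ℝ} (hT : 0 < T) {x y z : ℝ} (h : y + Tfloor T z ≤ x) :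
    Tfloor T y + Tfloor T z ≤ Tfloor T x := by
  have hy := (add_le_add_left (Tfloor_le hT y) _).trans h
  unfold Tfloor at hy ⊢
  rw [← mul_add] at hy ⊢
  refine mul_le_mul_of_nonneg_left ?_ hT.le
  rw [← Int.cast_add, Int.cast_le, Int.le_floor, le_div_iff₀ hT, mul_comm, Int.cast_add]
  exact hy

theorem stmt0 {G : Type*} [Group G] (T : ℝ) (hT : 0 < T)
    (Cp Cm : G → ℝ)
    (hle : ∀ g : G, Cm g ≤ Cp g)
    (hone : Cp 1 = 0 ∧ Cm 1 = 0)
    (htri : ∀ g h : G, Cp (g * h) ≤ Cp g + Tceil T (Cp h) ∧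
      Cm (g * h) ≥ Cm g + Tfloor T (Cm h))
    (hconj : ∀ g h : G, Tceil T (Cp (h * g * h⁻¹)) = Tceil T (Cp g) ∧
      Tfloor T (Cm (h * g * h⁻¹)) = Tfloor T (Cm g))
    (hdual : ∀ g : G, Tceil T (Cp g) = -(Tfloor T (Cm g⁻¹)))
    (μ : G → ℝ)
    (hμ : ∀ g : G, μ g = max (Tceil T (Cp g)) (-(Tfloor T (Cm g)))) :
    (∀ g : G, 0 ≤ μ g) ∧
    μ (1 : G) = 0 ∧
    (∀ g : G, μ g⁻¹ = μ g) ∧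
    (∀ g h : G, μ (g * h) ≤ μ g + μ h) ∧
    (∀ g h : G, μ (h * g * h⁻¹) = μ g) := by
  refine ⟨fun g => ?_, ?_, fun g => ?_, fun g h => ?_, fun g h => ?_⟩
  · rw [hμ]
    have hfloor := Tfloor_le hT (Cm g)
    have hceil := le_Tceil hT (Cp g)
    have hleft := le_max_left (Tceil T (Cp g)) (-(Tfloor T (Cm g)))
    have hright := le_max_right (Tceil T (Cp g)) (-(Tfloor T (Cm g)))
    linarith [hle g]
  · simp [hμ, hone, Tceil, Tfloor]
  · have hinv := hdual g⁻¹
    rw [inv_inv] at hinv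
    rw [hμ, hμ, hinv, ← hdual g, max_comm]
  · rw [hμ, hμ g, hμ h]
    refine max_le ?_ ?_
    · exact (Tceil_le_add hT (htri g h).1).trans
        (add_le_add (le_max_left _ _) (le_max_left _ _))
    · have hfloor := neg_le_neg (add_le_Tfloor hT (htri g h).2)
      rw [neg_add] at hfloor
      exact hfloor.trans (add_le_add (le_max_right _ _) (le_max_right _ _))
  · rw [hμ, hμ, (hconj g h).1, (hconj g h).2]
end

section
/- Let M be a compact Hausdorff topological space, N a positive integer, f : M → ℝ^N a continuous map, S a nonempty set of continuous maps M → M, and τ a real-valued function on subsets of M such that: (a) τ(M) = 1; (b) for every integer k ≥ 1 and all bounded open sets X₁, …, X_k ⊆ ℝ^N, τ(f⁻¹(X₁) ∪ ⋯ ∪ f⁻¹(X_k)) ≤ τ(f⁻¹(X₁)) + ⋯ + τ(f⁻¹(X_k)); (c) τ(f⁻¹(X)) = 0 for every bounded open set X ⊆ ℝ^N for which there exists φ ∈ S with φ(f⁻¹(X)) ∩ f⁻¹(X) = ∅. Then there exists a point y ∈ ℝ^N such that φ(f⁻¹({y})) ∩ f⁻¹({y}) ≠ ∅ for every φ ∈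 S. -/
/-- If a self-map displaces a fiber of a continuous map on a compact space, then it also displaces
the preimage of some ball around the base point. -/
theorem exists_ball_preimage_displaced {M Y : Type*} [TopologicalSpace M] [CompactSpace M]
    [MetricSpace Y] {f : M → Y} (hf : Continuous f) {φ : M → M} (hφ : Continuous φ) {y : Y}
    (h : φ '' (f ⁻¹' {y}) ∩ f ⁻¹' {y} = ∅) :
    ∃ r > 0, φ '' (f ⁻¹' Metric.ball y r) ∩ f ⁻¹' Metric.ball y r = ∅ := by
  have hK : IsClosed (Set.range fun x => (f x, f (φ x))) :=
    (isCompact_range (hf.prodMk (hf.comp hφ))).isClosed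
  have hy : (y, y) ∈ (Set.range fun x => (f x, f (φ x)))ᶜ := by
    rintro ⟨x, hx⟩
    obtain ⟨h₁, h₂⟩ := Prod.mk.inj hx
    exact Set.notMem_empty (φ x) (h ▸ ⟨⟨x, h₁, rfl⟩, h₂⟩)
  obtain ⟨r, hr, hball⟩ := Metric.isOpen_iff.1 hK.isOpen_compl _ hy
  refine ⟨r, hr, Set.eq_empty_iff_forall_notMem.2 ?_⟩
  rintro _ ⟨⟨x, hx, rfl⟩, hφx⟩
  rw [← ball_prod_same] at hball
  exact hball (Set.mk_mem_prod hx hφx) ⟨x, rfl⟩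

theorem stmt6 {M : Type*} [TopologicalSpace M] [CompactSpace M] [T2Space M]
    (N : ℕ) (hN : 0 < N)
    (f : M → EuclideanSpace ℝ (Fin N)) (hf : Continuous f)
    (S : Set (M → M)) (hS : ∀ φ ∈ S, Continuous φ) (hSne : S.Nonempty)
    (τ : Set M → ℝ)
    (hnorm : τ Set.univ = 1)
    (hsub : ∀ (k : ℕ), 1 ≤ k → ∀ X : Fin k → Set (EuclideanSpace ℝ (Fin N)),
      (∀ i, IsOpen (X i)) → (∀ i, Bornology.IsBounded (X i)) →
      τ (⋃ i, f ⁻¹' (X i)) ≤ ∑ i, τ (f ⁻¹' (X i)))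
    (hvan : ∀ X : Set (EuclideanSpace ℝ (Fin N)), IsOpen X → Bornology.IsBounded X →
      (∃ φ ∈ S, φ '' (f ⁻¹' X) ∩ f ⁻¹' X = ∅) → τ (f ⁻¹' X) = 0) :
    ∃ y : EuclideanSpace ℝ (Fin N), ∀ φ ∈ S,
      (φ '' (f ⁻¹' {y}) ∩ f ⁻¹' {y}).Nonempty := by
  by_contra! hcon
  have hdisp : ∀ y, ∃ r > 0, ∃ φ ∈ S,
      φ '' (f ⁻¹' Metric.ball y r) ∩ f ⁻¹' Metric.ball y r = ∅ := by
    intro y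
    obtain ⟨φ, hφ, hy⟩ := hcon y
    obtain ⟨r, hr, h⟩ := exists_ball_preimage_displaced hf (hS φ hφ) hy
    exact ⟨r, hr, φ, hφ, h⟩
  choose r hr hball using hdisp
  obtain ⟨t, -, ht⟩ := (isCompact_range hf).elim_nhds_subcover (fun y => Metric.ball y (r y))
    fun y _ => Metric.ball_mem_nhds y (hr y)
  -- Adjoining a point makes the index set nonempty even when `M` is empty.
  classical
  let e := (insert 0 t).equivFin
  have hcover : ⋃ i, f ⁻¹' Metric.ball (e.symm i : EuclideanSpace ℝ (Fin N)) (r (e.symm i)) =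
      Set.univ := by
    refine Set.eq_univ_of_forall fun x => ?_
    obtain ⟨y, hy, hxy⟩ := Set.mem_iUnion₂.1 (ht ⟨x, rfl⟩)
    refine Set.mem_iUnion.2 ⟨e ⟨y, Finset.mem_insert_of_mem hy⟩, ?_⟩
    simpa using hxy
  have hle := hsub _ (Finset.card_pos.2 (Finset.insert_nonempty 0 t))
    (fun i => Metric.ball (e.symm i : EuclideanSpace ℝ (Fin N)) (r (e.symm i)))
    (fun _ => Metric.isOpen_ball) (fun _ => Metric.isBounded_ball)
  rw [hcover, hnorm, Finset.sum_eq_zero fun i _ =>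
    hvan _ Metric.isOpen_ball Metric.isBounded_ball (hball _)] at hle
  exact absurd hle (by norm_num)
end

section
/- Let M be a topological space and let φ, φ', ρ : M → M be homeomorphisms such that ρ ∘ φ = φ ∘ ρ. Write Supp(φ) for the closure of {x ∈ M : φ(x) ≠ x}, and assume φ'(Supp(φ)) ∩ Supp(φ) = ∅. Then every x ∈ M with φ(φ'(x)) = ρ(x) satisfies φ'(x) = ρ(x). -/
theorem stmt12 {M : Type*} [TopologicalSpace M]
    (φ φ' ρ : M ≃ₜ M)
    (hcomm : ∀ x : M, ρ (φ x) = φ (ρ x))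
    (hdisp : φ' '' closure {x : M | φ x ≠ x} ∩ closure {x : M | φ x ≠ x} = ∅) :
    ∀ x : M, φ (φ' x) = ρ x → φ' x = ρ x := by
  intro x hx
  by_cases hfix : φ x = x
  · apply φ.injective
    rw [hx, ← hcomm, hfix]
  · have hmem : φ' x ∈ φ' '' closure {x : M | φ x ≠ x} :=
      Set.mem_image_of_mem φ' (subset_closure hfix)
    have hfix' : φ (φ' x) = φ' x := by
      by_contra hne
      exact Set.eq_empty_iff_forall_notMem.mp hdisp (φ' x) ⟨hmem, subset_closure hne⟩
    exact hfix'.symm.trans hx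
end

section
/- Let G be a group acting on a set X with a distinguished point Δ ∈ X. Let ⪯ be a preorder on X such that the G-action is order-preserving (x ⪯ y implies g·x ⪯ g·y for all g ∈ G). Let z : ℝ → G be a homomorphism from (ℝ,+) to G whose image lies in the center of G and which is monotone in the sense that s ≤ t implies z(s)·x ⪯ z(t)·x for every x ∈ X. Assume that for every g ∈ G the set A(g) := {t ∈ ℝ : g·Δ ⪯ z(t)·Δ} is nonempty and bounded below and the set B(g) := {t ∈ ℝ : z(t)·Δ ⪯ g·Δ} is nonempty and bounded above, and define C₊(g) := inf A(g) and C₋(g) := sup B(g). Let T > 0. Then for every g ∈ G such that C₊(g) ∉ Tℤ and C₋(g⁻¹) ∉ Tℤ, one has ⌈C₊(g)⌉_T = −⌊C₋(g⁻¹)⌋_T. -/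
theorem Tfloor_neg (T x : ℝ) : Tfloor T (-x) = -Tceil T x := by
  simp [Tfloor, Tceil, neg_div, Int.floor_neg]

/-- For a central one-parameter family `z`, inverting `g` exchanges the two sides of the order. -/
theorem rel_smul_inv_iff {G X : Type*} [Group G] [MulAction G X] (Δ : X) (r : X → X → Prop)
    (hact : ∀ (g : G) (x y : X), r x y → r (g • x) (g • y))
    (z : ℝ → G) (hhom : ∀ s t : ℝ, z (s + t) = z s * z t)
    (hcenter : ∀ (s : ℝ) (g : G), z s * g = g * z s) (g : G) (t : ℝ) :
    r (z t • Δ) (g⁻¹ • Δ) ↔ r (g • Δ) (z (-t) • Δ) := by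
  have hzero : z 0 = 1 := by simpa using hhom 0 0
  have hneg : z t * z (-t) = 1 := by rw [← hhom, add_neg_cancel, hzero]
  constructor
  · intro h
    have h' := hact (z (-t) * g) _ _ h
    rwa [smul_smul, smul_smul, mul_inv_cancel_right, hcenter, mul_assoc, hcenter (-t), hneg,
      mul_one] at h'
  · intro h
    have h' := hact (z t * g⁻¹) _ _ h
    rwa [smul_smul, smul_smul, inv_mul_cancel_right, hcenter, mul_assoc, hneg, mul_one] at h'

theorem stmt14 {G X : Type*} [Group G] [MulAction G X] (Δ : X)
    (r : X → X → Prop)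
    (hrefl : ∀ x : X, r x x)
    (htrans : ∀ x y z : X, r x y → r y z → r x z)
    (hact : ∀ (g : G) (x y : X), r x y → r (g • x) (g • y))
    (z : ℝ → G)
    (hhom : ∀ s t : ℝ, z (s + t) = z s * z t)
    (hcenter : ∀ (s : ℝ) (g : G), z s * g = g * z s)
    (hmono : ∀ s t : ℝ, s ≤ t → ∀ x : X, r (z s • x) (z t • x))
    (A : G → Set ℝ) (hA : ∀ g : G, A g = {t : ℝ | r (g • Δ) (z t • Δ)})
    (B : G → Set ℝ) (hB : ∀ g : G, B g = {t : ℝ | r (z t • Δ) (g • Δ)})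
    (hAne : ∀ g : G, (A g).Nonempty) (hAbdd : ∀ g : G, BddBelow (A g))
    (hBne : ∀ g : G, (B g).Nonempty) (hBbdd : ∀ g : G, BddAbove (B g))
    (Cp Cm : G → ℝ)
    (hCp : ∀ g : G, Cp g = sInf (A g))
    (hCm : ∀ g : G, Cm g = sSup (B g))
    (T : ℝ) (hT : 0 < T) :
    ∀ g : G, (∀ n : ℤ, Cp g ≠ T * n) → (∀ n : ℤ, Cm g⁻¹ ≠ T * n) →
      Tceil T (Cp g) = -(Tfloor T (Cm g⁻¹)) := by
  intro g _ _
  have hBA : B g⁻¹ = -A g := by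
    ext t
    rw [hB, Set.mem_neg, hA]
    exact rel_smul_inv_iff Δ r hact z hhom hcenter g t
  have hC : Cm g⁻¹ = -Cp g := by
    rw [hCm, hCp, hBA, Real.sInf_def, neg_neg]
  rw [hC, Tfloor_neg, neg_neg]
end

section
/- Let G be a group acting on a set X with a distinguished point Δ ∈ X. Let ⪯ be a preorder on X such that the G-action is order-preserving (x ⪯ y implies g·x ⪯ g·y for all g ∈ G). Let z : ℝ → G be a homomorphism from (ℝ,+) to G whose image lies in the center of G and which is monotone in the sense that s ≤ t implies z(s)·x ⪯ z(t)·x for every x ∈ X. Assume that for every g ∈ G the set A(g) := {t ∈ ℝ : g·Δ ⪯ z(t)·Δ} is nonempty and bounded below, and define C₊(g) := inf A(g). Let T > 0. Then for all g, h ∈ G with C₊(g) ∉ Tℤ, one has C₊(h·g) ≤ C₊(h) + ⌈C₊(g)⌉_T. -/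
/-- If the selector set `{t | r (g • x) (z t • x)}` contains `s` for `g` and `t` for `h`, it contains
`t + s` for `h * g`, provided `z` is central. -/
theorem rel_mul_smul_of_rel_smul {G X : Type*} [Group G] [MulAction G X] {r : X → X → Prop}
    (htrans : ∀ x y z : X, r x y → r y z → r x z)
    (hact : ∀ (g : G) (x y : X), r x y → r (g • x) (g • y))
    {z : ℝ → G} (hhom : ∀ s t : ℝ, z (s + t) = z s * z t)
    (hcenter : ∀ (s : ℝ) (g : G), z s * g = g * z s)
    {x : X} {g h : G} {s t : ℝ} (hs : r (g • x) (z s • x)) (ht : r (h • x) (z t • x)) :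
    r ((h * g) • x) (z (t + s) • x) := by
  have hleft : r ((h * g) • x) ((h * z s) • x) := by
    simpa only [mul_smul] using hact h _ _ hs
  have hright : r ((h * z s) • x) (z (t + s) • x) := by
    rw [← hcenter, hhom, hcenter t]
    simpa only [mul_smul] using hact (z s) _ _ ht
  exact htrans _ _ _ hleft hright

theorem stmt15 {G X : Type*} [Group G] [MulAction G X] (Δ : X)
    (r : X → X → Prop)
    (hrefl : ∀ x : X, r x x)
    (htrans : ∀ x y z : X, r x y → r y z → r x z)
    (hact : ∀ (g : G) (x y : X), r x y → r (g • x) (g • y))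
    (z : ℝ → G)
    (hhom : ∀ s t : ℝ, z (s + t) = z s * z t)
    (hcenter : ∀ (s : ℝ) (g : G), z s * g = g * z s)
    (hmono : ∀ s t : ℝ, s ≤ t → ∀ x : X, r (z s • x) (z t • x))
    (A : G → Set ℝ) (hA : ∀ g : G, A g = {t : ℝ | r (g • Δ) (z t • Δ)})
    (hAne : ∀ g : G, (A g).Nonempty) (hAbdd : ∀ g : G, BddBelow (A g))
    (Cp : G → ℝ)
    (hCp : ∀ g : G, Cp g = sInf (A g))
    (T : ℝ) (hT : 0 < T) :
    ∀ g h : G, (∀ n : ℤ, Cp g ≠ T * n) →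
      Cp (h * g) ≤ Cp h + Tceil T (Cp g) := by
  intro g h _
  refine le_trans ?_ (add_le_add_right (le_Tceil hT (Cp g)) (Cp h))
  have hadd : ∀ t ∈ A h, ∀ s ∈ A g, Cp (h * g) ≤ t + s := by
    intro t ht s hs
    rw [hA] at ht hs
    rw [hCp]
    refine csInf_le (hAbdd _) ?_
    rw [hA]
    exact rel_mul_smul_of_rel_smul htrans hact hhom hcenter hs ht
  have hg : ∀ t ∈ A h, Cp (h * g) - t ≤ Cp g := fun t ht => by
    rw [hCp g]
    exact le_csInf (hAne g) fun s hs => by linarith [hadd t ht s hs]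
  have hh : Cp (h * g) - Cp g ≤ Cp h := by
    rw [hCp h]
    exact le_csInf (hAne h) fun t ht => by linarith [hg t ht]
  linarith
end
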